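/- Fix Δt > 0, an integer N ≥ 2, and T > 0 with N·Δt ≤ T, and set t^k := k·Δt. Let E be a real Banach space, let u : ℝ → E be four times continuously differentiable, and for each n with 1 ≤ n ≤ N − 1 define r^n := (1/Δt²)·[ −∫_{t^{n−1}}^{t^n} ((t^{n−1} − s)³/6)·u⁽⁴⁾(s) ds + ∫_{t^n}^{t^{n+1}} ((t^{n+1} − s)³/6)·u⁽⁴⁾(s) ds ]. Then ∑_{n=1}^{N−1} ‖r^n‖² ≤ (Δt³/63) · ∫_0^T ‖u⁽⁴⁾(s)‖² ds. -/

import Mathlib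

open MeasureTheory intervalIntegral Finset

/-- Cauchy-Schwarz inequality for interval integrals of continuous real functions. -/
theorem sq_integral_mul_le_of_continuous {a b : ℝ} (hab : a ≤ b) {v g : ℝ → ℝ}
    (hv : Continuous v) (hg : Continuous g) :
    (∫ s in a..b, v s * g s) ^ 2 ≤ (∫ s in a..b, v s ^ 2) * ∫ s in a..b, g s ^ 2 := by
  have key : ∀ x : ℝ, 0 ≤ (∫ s in a..b, v s ^ 2) * (x * x) +
      (2 * ∫ s in a..b, v s * g s) * x + ∫ s in a..b, g s ^ 2 := by
    intro x
    have h_nonneg : 0 ≤ ∫ s in a..b, (x * v s + g s) ^ 2 :=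
      intervalIntegral.integral_nonneg hab fun s _ => sq_nonneg _
    have h_expand : ∫ s in a..b, (x * v s + g s) ^ 2 =
        ∫ s in a..b, (x * x * v s ^ 2 + 2 * x * (v s * g s) + g s ^ 2) := by
      congr 1
      ext s
      ring
    rw [h_expand, intervalIntegral.integral_add
        (Continuous.intervalIntegrable (by fun_prop) _ _)
        (Continuous.intervalIntegrable (by fun_prop) _ _),
      intervalIntegral.integral_add
        (Continuous.intervalIntegrable (by fun_prop) _ _)
        (Continuous.intervalIntegrable (by fun_prop) _ _),
      intervalIntegral.integral_const_mul, intervalIntegral.integral_const_mul] at h_nonneg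
    linarith
  have h := discrim_le_zero key
  rw [discrim] at h
  linarith

theorem sq_norm_integral_smul_le_of_continuous {E : Type*} [NormedAddCommGroup E]
    [NormedSpace ℝ E] {a b : ℝ} (hab : a ≤ b) {v : ℝ → ℝ} {f : ℝ → E}
    (hv : Continuous v) (hf : Continuous f) :
    ‖∫ s in a..b, v s • f s‖ ^ 2 ≤ (∫ s in a..b, v s ^ 2) * ∫ s in a..b, ‖f s‖ ^ 2 := by
  have h_norm : ‖∫ s in a..b, v s • f s‖ ≤ ∫ s in a..b, |v s| * ‖f s‖ := by
    simpa only [norm_smul, Real.norm_eq_abs] using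
      intervalIntegral.norm_integral_le_integral_norm (f := fun s => v s • f s) hab
  have h_cs := sq_integral_mul_le_of_continuous hab hv.abs hf.norm
  simp only [sq_abs] at h_cs
  exact (pow_le_pow_left₀ (norm_nonneg _) h_norm 2).trans h_cs

theorem integral_sq_cubic_kernel (a b c : ℝ) :
    ∫ s in a..b, ((c - s) ^ 3 / 6) ^ 2 = ((c - a) ^ 7 - (c - b) ^ 7) / 252 := by
  rw [intervalIntegral.integral_comp_sub_left (fun x : ℝ => (x ^ 3 / 6) ^ 2) c]
  have h : (fun x : ℝ => (x ^ 3 / 6) ^ 2) = fun x => x ^ 6 / 36 := by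
    ext x
    ring
  rw [h, intervalIntegral.integral_div, integral_pow]
  norm_num
  ring

/-- The squared norm of the Taylor remainder of a central second difference quotient is
controlled by the energy over the two adjacent time steps. -/
theorem sq_norm_central_second_difference_remainder_le {E : Type*} [NormedAddCommGroup E]
    [NormedSpace ℝ E] {a b c d : ℝ} (hd : 0 < d) (hab : b = a + d) (hbc : c = b + d)
    {f : ℝ → E} (hf : Continuous f) :
    ‖(d ^ 2)⁻¹ • (-(∫ s in a..b, ((a - s) ^ 3 / 6) • f s) +
        ∫ s in b..c, ((c - s) ^ 3 / 6) • f s)‖ ^ 2 ≤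
      d ^ 3 / 126 * ∫ s in a..c, ‖f s‖ ^ 2 := by
  have h_left := sq_norm_integral_smul_le_of_continuous (a := a) (b := b)
    (v := fun s => (a - s) ^ 3 / 6) (by linarith) (by fun_prop) hf
  have h_right := sq_norm_integral_smul_le_of_continuous (a := b) (b := c)
    (v := fun s => (c - s) ^ 3 / 6) (by linarith) (by fun_prop) hf
  have h_left_weight : ((a - a) ^ 7 - (a - b) ^ 7) / 252 = d ^ 7 / 252 := by
    rw [hab]
    ring
  have h_right_weight : ((c - b) ^ 7 - (c - c) ^ 7) / 252 = d ^ 7 / 252 := by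
    rw [hbc]
    ring
  rw [integral_sq_cubic_kernel, h_left_weight] at h_left
  rw [integral_sq_cubic_kernel, h_right_weight] at h_right
  have h_sq : Continuous fun s => ‖f s‖ ^ 2 := by fun_prop
  rw [← intervalIntegral.integral_add_adjacent_intervals
    (h_sq.intervalIntegrable a b) (h_sq.intervalIntegrable b c)]
  set p := ∫ s in a..b, ((a - s) ^ 3 / 6) • f s
  set q := ∫ s in b..c, ((c - s) ^ 3 / 6) • f s
  have h_triangle : ‖-p + q‖ ^ 2 ≤ 2 * (‖p‖ ^ 2 + ‖q‖ ^ 2) := by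
    have h := norm_add_le (-p) q
    rw [norm_neg] at h
    exact (pow_le_pow_left₀ (norm_nonneg _) h 2).trans add_sq_le
  rw [norm_smul, mul_pow, Real.norm_of_nonneg (by positivity)]
  calc ((d ^ 2)⁻¹) ^ 2 * ‖-p + q‖ ^ 2
      ≤ ((d ^ 2)⁻¹) ^ 2 * (2 * (d ^ 7 / 252 * (∫ s in a..b, ‖f s‖ ^ 2) +
          d ^ 7 / 252 * ∫ s in b..c, ‖f s‖ ^ 2)) := by
        gcongr
        linarith
    _ = d ^ 3 / 126 * ((∫ s in a..b, ‖f s‖ ^ 2) + ∫ s in b..c, ‖f s‖ ^ 2) := by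
        field_simp
        ring

theorem sum_Icc_one_central_difference (F : ℝ → ℝ) (d : ℝ) (m : ℕ) :
    ∑ n ∈ Finset.Icc 1 m, (F (((n : ℝ) + 1) * d) - F (((n : ℝ) - 1) * d)) =
      F (((m : ℝ) + 1) * d) + F (m * d) - F d - F 0 := by
  induction m with
  | zero => simp
  | succ m ih =>
    rw [Finset.sum_Icc_succ_top (by omega), ih]
    push_cast
    rw [add_sub_cancel_right]
    ring

/-- Summed bound on the squared norms of the Taylor remainders of the central
second difference quotients. -/
theorem central_second_difference_remainder_sq_sum_bound
    {E : Type*} [NormedAddCommGroup E] [NormedSpace ℝ E] [CompleteSpace E]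
    (Δt T : ℝ) (hΔt : 0 < Δt) (hT : 0 < T) (N : ℕ) (hN : 2 ≤ N)
    (hNT : (N : ℝ) * Δt ≤ T)
    (u : ℝ → E) (hu : ContDiff ℝ 4 u) :
    ∑ n ∈ Finset.Icc 1 (N - 1),
      ‖(Δt ^ 2)⁻¹ • (-(∫ s in (((n : ℝ) - 1) * Δt)..((n : ℝ) * Δt),
            ((((n : ℝ) - 1) * Δt - s) ^ 3 / 6) • iteratedDeriv 4 u s) +
          ∫ s in ((n : ℝ) * Δt)..(((n : ℝ) + 1) * Δt),
            ((((n : ℝ) + 1) * Δt - s) ^ 3 / 6) • iteratedDeriv 4 u s)‖ ^ 2 ≤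
      (Δt ^ 3 / 63) * ∫ s in (0 : ℝ)..T, ‖iteratedDeriv 4 u s‖ ^ 2 := by
  have hf : Continuous (iteratedDeriv 4 u) := hu.continuous_iteratedDeriv 4 le_rfl
  have h_sq : Continuous fun s => ‖iteratedDeriv 4 u s‖ ^ 2 := by fun_prop
  set F : ℝ → ℝ := fun x => ∫ s in (0 : ℝ)..x, ‖iteratedDeriv 4 u s‖ ^ 2
  have hF_sub : ∀ a b, F b - F a = ∫ s in a..b, ‖iteratedDeriv 4 u s‖ ^ 2 := fun a b =>
    intervalIntegral.integral_interval_sub_left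
      (h_sq.intervalIntegrable 0 b) (h_sq.intervalIntegrable 0 a)
  have hF_mono : Monotone F := fun a b hab => by
    have h : 0 ≤ F b - F a := by
      rw [hF_sub]
      exact intervalIntegral.integral_nonneg hab fun s _ => sq_nonneg _
    linarith
  have hF_zero : F 0 = 0 := intervalIntegral.integral_same
  have hF_step : 0 ≤ F Δt := hF_zero ▸ hF_mono hΔt.le
  have h_cast : ((N - 1 : ℕ) : ℝ) = N - 1 := by
    rw [Nat.cast_sub (by omega), Nat.cast_one]
  have h_last : F ((((N - 1 : ℕ) : ℝ) + 1) * Δt) ≤ F T :=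
    hF_mono (by rw [h_cast]; linarith)
  have h_prev : F (((N - 1 : ℕ) : ℝ) * Δt) ≤ F T :=
    hF_mono (by rw [h_cast]; linarith)
  calc _ ≤ ∑ n ∈ Finset.Icc 1 (N - 1),
        Δt ^ 3 / 126 * (F (((n : ℝ) + 1) * Δt) - F (((n : ℝ) - 1) * Δt)) := by
        refine Finset.sum_le_sum fun n _ => ?_
        rw [hF_sub]
        exact sq_norm_central_second_difference_remainder_le hΔt (by ring) (by ring) hf
    _ ≤ Δt ^ 3 / 126 * (2 * F T) := by
        rw [← Finset.mul_sum, sum_Icc_one_central_difference]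
        gcongr
        linarith
    _ = (Δt ^ 3 / 63) * F T := by ring
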